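/- Generating function for symmetric cylindric partitions (product-of-Φ form): let δ=(δ_1,...,δ_h) be a profile. Then Σ_{ω ∈ SCP_δ} z^{|ω|} = ∏_{i<j, δ_i>δ_j} (1−z^{2(j−i)})^{−1} · Φ({z^{2i−1} : δ_i=−1}) · ∏_{k≥1} Φ(z^{(2h+1)k}({z^{−2i+1} : δ_i=1} + {z^{2i−1} : δ_i=−1}))/(1−z^{(2h+1)k}), as an identity of formal power series in z, where SCP_δ is the set of symmetric cylindric partitions with profile δ. -/

import Mathlib

open scoped BigOperators

/-- An integer partition: a weakly decreasing, finitely supported sequence of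
nonnegative integers. -/
structure Ptn where
  toFun : ℕ →₀ ℕ
  antitone' : ∀ ⦃i j : ℕ⦄, i ≤ j → toFun j ≤ toFun i

namespace Ptn
/-- the `i`-th part (0-indexed) -/
def part (lam : Ptn) (i : ℕ) : ℕ := lam.toFun i
/-- the size `|λ|` -/
def size (lam : Ptn) : ℕ := lam.toFun.sum fun _ k => k
end Ptn

/-- `HStrip μ λ` means `μ ≺ λ`, i.e. `λ/μ` is a horizontal strip:
`λ_i ≥ μ_i ≥ λ_{i+1}` for all `i`. -/
def HStrip (mu lam : Ptn) : Prop :=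
  ∀ i : ℕ, mu.part i ≤ lam.part i ∧ lam.part (i + 1) ≤ mu.part i
/-- Chains of partitions `μ = c 0 ≺ c 1 ≺ ⋯` stabilizing at `λ`; these encode
semistandard Young tableaux of shape `λ/μ` with entries in `{0, 1, 2, …}`. -/
def IsSchurChain (mu lam : Ptn) (c : ℕ → Ptn) : Prop :=
  c 0 = mu ∧ (∀ i, HStrip (c i) (c (i + 1))) ∧ ∃ N, ∀ i, N ≤ i → c i = lam

/-- the monomial attached to a chain: the variable `X i` records the cells added
at step `i` of the chain -/
noncomputable def chainWeight {R : Type*} [CommRing R] (X : ℕ → R) (c : ℕ → Ptn) : R :=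
  ∏ᶠ i : ℕ, X i ^ ((c (i + 1)).size - (c i).size)

/-- the skew Schur function `s_{λ/μ}(X)` (which is `0` if `μ ⊄ λ`) -/
noncomputable def skewSchur {R : Type*} [CommRing R] [TopologicalSpace R]
    (X : ℕ → R) (lam mu : Ptn) : R :=
  ∑' c : {c : ℕ → Ptn // IsSchurChain mu lam c}, chainWeight X c.1

/-- `Ψ(X,Y) = ∏_{i,j} (1 - x_i y_j)⁻¹` -/
noncomputable def Psi {R : Type*} [CommRing R] [TopologicalSpace R] [Inv R] (X Y : ℕ → R) : R :=
  ∏' p : ℕ × ℕ, (1 - X p.1 * Y p.2)⁻¹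

/-- `Φ(X) = ∏_i (1 - x_i)⁻¹ ∏_{i<j} (1 - x_i x_j)⁻¹` -/
noncomputable def Phi {R : Type*} [CommRing R] [TopologicalSpace R] [Inv R] (X : ℕ → R) : R :=
  (∏' i : ℕ, (1 - X i)⁻¹) * ∏' p : {q : ℕ × ℕ // q.1 < q.2}, (1 - X p.1.1 * X p.1.2)⁻¹
/-- `δ` is a `±1`-profile on the indices `1, …, h` -/
def IsProfile (h : ℕ) (δ : ℕ → ℤ) : Prop := ∀ i, 1 ≤ i → i ≤ h → δ i = 1 ∨ δ i = -1

/-- A skew doubled shifted plane partition `ω = (λ^0, …, λ^{m-1})` with profile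
`(δ_1, …, δ_{m-1})`: if `δ_{i+1} = 1` then `λ^i ≺ λ^{i+1}`, and if
`δ_{i+1} = -1` then `λ^i ≻ λ^{i+1}`. -/
def IsDSPP (m : ℕ) (δ : ℕ → ℤ) (L : Fin m → Ptn) : Prop :=
  ∀ (i : ℕ) (hi : i + 1 < m),
    if δ (i + 1) = 1 then HStrip (L ⟨i, Nat.lt_of_succ_lt hi⟩) (L ⟨i + 1, hi⟩)
    else HStrip (L ⟨i + 1, hi⟩) (L ⟨i, Nat.lt_of_succ_lt hi⟩)
/-- the coefficientwise (product) topology on multivariate formal power series -/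
instance (σ : Type*) : TopologicalSpace (MvPowerSeries σ ℚ) :=
  inferInstanceAs (TopologicalSpace ((σ →₀ ℕ) → ℚ))
/-- the coefficientwise (product) topology on formal power series -/
instance : TopologicalSpace (PowerSeries ℚ) :=
  inferInstanceAs (TopologicalSpace ((Unit →₀ ℕ) → ℚ))

/-- the doubled profile `(-δ_h, …, -δ_1, δ_1, …, δ_h)` of the profile
`δ = (δ_1, …, δ_h)` -/
def dblProfile (h : ℕ) (δ : ℕ → ℤ) : ℕ → ℤ :=
  fun j => if j ≤ h then -δ (h + 1 - j) else δ (j - h)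

/-- A symmetric cylindric partition with profile `δ = (δ_1, …, δ_h)`: a skew
doubled shifted plane partition `ω = (λ^h, …, λ^1, λ^0, λ^1, …, λ^h)` (a
palindromic sequence of `2h+1` partitions) with the doubled profile
`(-δ_h, …, -δ_1, δ_1, …, δ_h)`. -/
def IsSCP (h : ℕ) (δ : ℕ → ℤ) (M : Fin (2 * h + 1) → Ptn) : Prop :=
  IsDSPP (2 * h + 1) (dblProfile h δ) M ∧
    ∀ k : Fin (2 * h + 1), M k = M ⟨2 * h - (k : ℕ), by omega⟩

/-- the size `|ω| = |λ^0| + 2 Σ_{i=1}^h |λ^i|` of a symmetric cylindric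
partition -/
noncomputable def scpSize (h : ℕ) (M : Fin (2 * h + 1) → Ptn) : ℕ :=
  (M ⟨h, by omega⟩).size +
    2 * ∑ i : Fin h, (M ⟨h + (i : ℕ) + 1, by have := i.isLt; omega⟩).size

/-- the formal variable `z` -/
noncomputable def z : PowerSeries ℚ := PowerSeries.X

/-- The generating function of an integer weight: the coefficient of `z ^ n` counts the elements
of weight `n`. -/
noncomputable def weightGF {T : Type} (w : T → ℤ) : PowerSeries ℚ :=
  PowerSeries.mk fun n => (Nat.card {t // w t = n} : ℚ)

/-- A weight is admissible if it is nonnegative and has finite fibres. -/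
structure Admissible {T : Type} (w : T → ℤ) : Prop where
  nonneg : ∀ t, 0 ≤ w t
  finite : ∀ n : ℤ, Finite {t // w t = n}

/-- `Reduces m A B`: the weight `A` is the sum of `B` and of a free part of size `m` with
arbitrary multiplicity. -/
def Reduces {T T' : Type} (m : ℤ) (A : T → ℤ) (B : T' → ℤ) : Prop :=
  ∃ E : T ≃ T' × ℕ, ∀ t, A t = B (E t).1 + m * (E t).2

/-- The geometric series `(1 - z ^ m)⁻¹`. -/
noncomputable def geomSeries (m : ℤ) : PowerSeries ℚ := (1 - z ^ m.toNat)⁻¹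

theorem constantCoeff_one_sub_z_pow {a : ℕ} (ha : 0 < a) :
    PowerSeries.constantCoeff (1 - z ^ a) ≠ 0 := by
  simp [z, ha.ne']

/-- Splitting off the configurations in which the free part does not occur. -/
def freePartEquiv {T : Type} (m : ℤ) (B : T → ℤ) (n : ℤ) :
    {p : T × ℕ // B p.1 + m * p.2 = n} ≃
      {t // B t = n} ⊕ {p : T × ℕ // B p.1 + m * p.2 = n - m} where
  toFun
    | ⟨(t, 0), h⟩ => Sum.inl ⟨t, by simpa using h⟩
    | ⟨(t, k + 1), h⟩ => Sum.inr ⟨(t, k), by push_cast at h; simp only; linarith⟩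
  invFun
    | Sum.inl ⟨t, h⟩ => ⟨(t, 0), by simpa using h⟩
    | Sum.inr ⟨(t, k), h⟩ => ⟨(t, k + 1), by push_cast; simp only at h; linarith⟩
  left_inv := by rintro ⟨⟨t, _ | k⟩, h⟩ <;> rfl
  right_inv := by rintro (⟨t, h⟩ | ⟨⟨t, k⟩, h⟩) <;> rfl

theorem Admissible.of_injective {T T' : Type} {A : T → ℤ} {B : T' → ℤ} (hA : Admissible A)
    (f : T' → T) (hf : Function.Injective f) (h : ∀ t, A (f t) = B t) : Admissible B where
  nonneg t := h t ▸ hA.nonneg _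
  finite n := by
    have := hA.finite n
    refine Finite.of_injective (β := {t // A t = n})
      (fun t => ⟨f t.1, (h t.1).trans t.2⟩) fun a b hab => ?_
    exact Subtype.ext (hf (congrArg Subtype.val hab))

theorem weightGF_congr {T T' : Type} {A : T → ℤ} {B : T' → ℤ} (e : T ≃ T')
    (h : ∀ t, A t = B (e t)) : weightGF A = weightGF B := by
  ext n
  simp only [weightGF, PowerSeries.coeff_mk]
  exact congrArg _ (Nat.card_congr (e.subtypeEquiv fun t => by rw [h]))

theorem Reduces.weightGF_eq {T T' : Type} {m : ℤ} {A : T → ℤ} {B : T' → ℤ}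
    (h : Reduces m A B) (hm : 0 < m) (hA : Admissible A) :
    Admissible B ∧ weightGF A = geomSeries m * weightGF B := by
  obtain ⟨E, hE⟩ := h
  have hB : Admissible B := hA.of_injective (fun t => E.symm (t, 0))
    (fun a b hab => by simpa using hab) fun t => by simp [hE]
  refine ⟨hB, ?_⟩
  lift m to ℕ using hm.le
  rw [geomSeries, Int.toNat_natCast, mul_comm,
    PowerSeries.eq_mul_inv_iff_mul_eq (constantCoeff_one_sub_z_pow (by exact_mod_cast hm))]
  ext n
  have e : ∀ k : ℤ, {t // A t = k} ≃ {p : T' × ℕ // B p.1 + (m : ℤ) * p.2 = k} := fun k =>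
    E.subtypeEquiv fun t => by rw [hE]
  have key : Nat.card {t // A t = (n : ℤ)} =
      Nat.card {t // B t = (n : ℤ)} + Nat.card {t // A t = (n : ℤ) - m} := by
    have := hB.finite n
    have := hA.finite (n - m)
    rw [← Nat.card_sum]
    exact Nat.card_congr ((e n).trans ((freePartEquiv _ _ _).trans
      (Equiv.sumCongr (Equiv.refl _) (e _).symm)))
  rw [mul_sub, mul_one, map_sub, z, PowerSeries.coeff_mul_X_pow']
  simp only [weightGF, PowerSeries.coeff_mk, key]
  split_ifs with hmn
  · push_cast [Nat.cast_sub hmn]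
    ring
  · have : IsEmpty {t // A t = (n : ℤ) - m} :=
      ⟨fun t => by have := hA.nonneg t.1; have := t.2; omega⟩
    simp

namespace Ptn

@[ext] theorem ext {l m : Ptn} (h : ∀ i, l.part i = m.part i) : l = m := by
  cases l; cases m
  simp only [mk.injEq]
  exact Finsupp.ext h

theorem part_anti (l : Ptn) {i j : ℕ} (h : i ≤ j) : l.part j ≤ l.part i := l.antitone' h

/-- The partition with the given parts. -/
noncomputable def ofParts (f : ℕ → ℕ) (hf : ∀ i, f (i + 1) ≤ f i) (N : ℕ) (hN : ∀ i, N ≤ i → f i = 0) :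
    Ptn where
  toFun := Finsupp.onFinset (Finset.range N) f fun i hi => by
    by_contra h
    exact hi (hN i (by simpa using h))
  antitone' _ _ h := antitone_nat_of_succ_le hf h

@[simp] theorem part_ofParts (f : ℕ → ℕ) (hf N hN) (i : ℕ) :
    (ofParts f hf N hN).part i = f i := rfl

theorem exists_part_eq_zero (l : Ptn) : ∃ N, ∀ i, N ≤ i → l.part i = 0 := by
  refine ⟨l.toFun.support.sup id + 1, fun i hi => ?_⟩
  by_contra h
  have := Finset.le_sup (f := id) (Finsupp.mem_support_iff.2 h)
  simp only [id] at this
  omega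

theorem size_eq_sum (l : Ptn) {N : ℕ} (hN : ∀ i, N ≤ i → l.part i = 0) :
    l.size = ∑ i ∈ Finset.range N, l.part i := by
  refine Finset.sum_subset (fun i hi => ?_) fun i _ hi => ?_
  · by_contra h
    exact Finsupp.mem_support_iff.1 hi (hN i (by simpa using h))
  · simpa using hi

theorem sum_part_le_size (l : Ptn) (s : Finset ℕ) : ∑ i ∈ s, l.part i ≤ l.size := by
  obtain ⟨N, hN⟩ := l.exists_part_eq_zero
  rw [l.size_eq_sum (N := max N (s.sup id + 1)) fun i hi => hN i (by omega)]
  refine Finset.sum_le_sum_of_subset fun i hi => ?_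
  have := Finset.le_sup (f := id) hi
  simp only [id] at this
  rw [Finset.mem_range]
  omega

theorem part_le_size (l : Ptn) (i : ℕ) : l.part i ≤ l.size := by
  simpa using l.sum_part_le_size {i}

theorem part_eq_zero_of_size_le (l : Ptn) {i : ℕ} (h : l.size ≤ i) : l.part i = 0 := by
  by_contra hne
  have h1 := l.sum_part_le_size (Finset.range (i + 1))
  have h2 : ∑ _j ∈ Finset.range (i + 1), 1 ≤ ∑ j ∈ Finset.range (i + 1), l.part j :=
    Finset.sum_le_sum fun j hj => by
      have := l.part_anti (Nat.lt_succ_iff.1 (Finset.mem_range.1 hj))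
      omega
  simp only [Finset.sum_const, Finset.card_range, smul_eq_mul, mul_one] at h2
  omega

instance finite_size_le (n : ℕ) : Finite {l : Ptn // l.size ≤ n} := by
  refine Finite.of_injective (β := Fin n → Fin (n + 1))
    (fun l i => ⟨l.1.part i, by have := l.1.part_le_size i; have := l.2; omega⟩)
    fun a b hab => Subtype.ext (Ptn.ext fun i => ?_)
  by_cases hi : i < n
  · simpa using congrFun hab ⟨i, hi⟩
  · rw [a.1.part_eq_zero_of_size_le (a.2.trans (by omega)),
      b.1.part_eq_zero_of_size_le (b.2.trans (by omega))]

end Ptn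

theorem HStrip.size_le {m l : Ptn} (h : HStrip m l) : m.size ≤ l.size := by
  obtain ⟨N, hN⟩ := l.exists_part_eq_zero
  rw [l.size_eq_sum hN, m.size_eq_sum fun i hi => by have := (h i).1; rw [hN i hi] at this; omega]
  exact Finset.sum_le_sum fun i _ => (h i).1

theorem HStrip.eq_of_size_le {m l : Ptn} (h : HStrip m l) (hs : l.size ≤ m.size) : m = l := by
  obtain ⟨N, hN⟩ := l.exists_part_eq_zero
  have hN' : ∀ i, N ≤ i → m.part i = 0 := fun i hi => by
    have := (h i).1; rw [hN i hi] at this; omega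
  have hs' := le_antisymm h.size_le hs
  rw [l.size_eq_sum hN, m.size_eq_sum hN',
    Finset.sum_eq_sum_iff_of_le fun i _ => (h i).1] at hs'
  ext i
  by_cases hi : i < N
  · exact hs' i (by simpa using hi)
  · rw [hN i (by omega), hN' i (by omega)]

theorem HStrip.refl (l : Ptn) : HStrip l l := fun i => ⟨le_rfl, l.part_anti (Nat.le_add_right i 1)⟩

/-- Reflecting all parts of a partition `l ≻ m, n` except the largest one in the intervals they
range over yields a partition below `m` and `n`; the largest part leaves a free integer. -/
noncomputable def toggle (m n : Ptn) :
    {l // HStrip m l ∧ HStrip n l} ≃ {k // HStrip k m ∧ HStrip k n} × ℕ where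
  toFun l :=
    (⟨Ptn.ofParts
        (fun i => max (m.part (i + 1)) (n.part (i + 1)) + min (m.part i) (n.part i)
          - l.1.part (i + 1))
        (fun i => by
          have := l.2.1 i; have := l.2.1 (i + 1); have := l.2.1 (i + 1 + 1)
          have := l.2.2 i; have := l.2.2 (i + 1); have := l.2.2 (i + 1 + 1)
          have := m.part_anti (Nat.le_add_right (i + 1) 1); have := n.part_anti (Nat.le_add_right (i + 1) 1)
          omega)
        (l.1.size) (fun i hi => by
          have h1 := l.1.part_eq_zero_of_size_le hi
          have := l.1.part_eq_zero_of_size_le (hi.trans (Nat.le_add_right i 1))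
          have := l.2.1 i; have := l.2.1 (i + 1)
          have := l.2.2 i; have := l.2.2 (i + 1)
          omega),
      ⟨fun i => by
        have := l.2.1 i; have := l.2.1 (i + 1); have := l.2.2 i; have := l.2.2 (i + 1)
        simp only [Ptn.part_ofParts]
        omega,
       fun i => by
        have := l.2.1 i; have := l.2.1 (i + 1); have := l.2.2 i; have := l.2.2 (i + 1)
        simp only [Ptn.part_ofParts]
        omega⟩⟩,
     l.1.part 0 - max (m.part 0) (n.part 0))
  invFun p :=
    ⟨Ptn.ofParts
        (fun i => match i with
          | 0 => p.2 + max (m.part 0) (n.part 0)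
          | i + 1 => max (m.part (i + 1)) (n.part (i + 1)) + min (m.part i) (n.part i)
              - p.1.1.part i)
        (fun i => by
          have := p.1.2.1 i; have := p.1.2.2 i
          rcases i with _ | i
          · simp only
            omega
          · have := p.1.2.1 (i + 1); have := p.1.2.2 (i + 1)
            have := p.1.2.1 i; have := p.1.2.2 i
            have := m.part_anti (Nat.le_add_right (i + 1) 1); have := n.part_anti (Nat.le_add_right (i + 1) 1)
            simp only
            omega)
        (max m.size n.size + 1) (fun i hi => by
          rcases i with _ | i
          · omega
          · have := m.part_eq_zero_of_size_le (i := i) (by omega)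
            have := n.part_eq_zero_of_size_le (i := i) (by omega)
            have := m.part_anti (Nat.le_add_right i 1); have := n.part_anti (Nat.le_add_right i 1)
            simp only
            omega),
      ⟨fun i => by
        have := p.1.2.1 i; have := p.1.2.2 i
        simp only [Ptn.part_ofParts]
        rcases i with _ | i
        · simp only; omega
        · have := p.1.2.1 i; have := p.1.2.2 i
          simp only; omega,
       fun i => by
        have := p.1.2.1 i; have := p.1.2.2 i
        simp only [Ptn.part_ofParts]
        rcases i with _ | i
        · simp only; omega
        · have := p.1.2.1 i; have := p.1.2.2 i
          simp only; omega⟩⟩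
  left_inv l := by
    refine Subtype.ext (Ptn.ext fun i => ?_)
    rcases i with _ | i
    · have := l.2.1 0; have := l.2.2 0
      simp only [Ptn.part_ofParts]
      omega
    · have := l.2.1 i; have := l.2.1 (i + 1); have := l.2.2 i; have := l.2.2 (i + 1)
      simp only [Ptn.part_ofParts]
      omega
  right_inv p := by
    refine Prod.ext (Subtype.ext (Ptn.ext fun i => ?_)) ?_
    · have := p.1.2.1 i; have := p.1.2.2 i
      simp only [Ptn.part_ofParts]
      omega
    · simp only [Ptn.part_ofParts]
      omega

theorem size_add_size_toggle (m n : Ptn) (l : {l // HStrip m l ∧ HStrip n l}) :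
    l.1.size + (toggle m n l).1.1.size = m.size + n.size + (toggle m n l).2 := by
  have h1 := fun i => l.2.1 i
  have h2 := fun i => l.2.2 i
  obtain ⟨N, hN⟩ := l.1.exists_part_eq_zero
  have hm : ∀ i, N ≤ i → m.part i = 0 := fun i hi => by have := h1 i; have := hN i hi; omega
  have hn : ∀ i, N ≤ i → n.part i = 0 := fun i hi => by have := h2 i; have := hN i hi; omega
  have hk : ∀ i, N ≤ i → (toggle m n l).1.1.part i = 0 := fun i hi => by
    have := (toggle m n l).1.2.1 i; have := hm i hi; omega
  rw [l.1.size_eq_sum (N := N + 1) fun i hi => hN i (by omega), Ptn.size_eq_sum _ hk,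
    m.size_eq_sum hm, n.size_eq_sum hn, Finset.sum_range_succ', add_right_comm,
    ← Finset.sum_add_distrib]
  have hsum : ∑ i ∈ Finset.range N, (l.1.part (i + 1) + (toggle m n l).1.1.part i) =
      ∑ i ∈ Finset.range N,
        (max (m.part (i + 1)) (n.part (i + 1)) + min (m.part i) (n.part i)) := by
    refine Finset.sum_congr rfl fun i _ => ?_
    have := h1 i; have := h1 (i + 1); have := h2 i; have := h2 (i + 1)
    simp only [toggle, Equiv.coe_fn_mk, Ptn.part_ofParts]
    omega
  have hmax := Finset.sum_range_succ' (fun i => max (m.part i) (n.part i)) N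
  rw [Finset.sum_range_succ, hm N le_rfl, hn N le_rfl] at hmax
  have hmm : ∑ i ∈ Finset.range N, (max (m.part i) (n.part i) + min (m.part i) (n.part i)) =
      ∑ i ∈ Finset.range N, (m.part i + n.part i) :=
    Finset.sum_congr rfl fun i _ => max_add_min _ _
  have hsnd : (toggle m n l).2 = l.1.part 0 - max (m.part 0) (n.part 0) := rfl
  rw [hsum, hsnd]
  simp only [Finset.sum_add_distrib] at hmm ⊢
  have := h1 0; have := h2 0
  simp only [max_self] at hmax
  omega

/-- The relation imposed on consecutive partitions by an ascending (`true`) or descending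
(`false`) step. -/
def Step : Bool → Ptn → Ptn → Prop
  | true, m, l => HStrip m l
  | false, m, l => HStrip l m

/-- Sequences of partitions starting at a given one, with prescribed directions of the steps. Each
step carries the exponent of its variable. -/
def Walk : List (Bool × ℤ) → Ptn → Type
  | [], _ => Unit
  | a :: s, m => Σ l : {l // Step a.1 m l}, Walk s l.1

/-- The signed number of cells moved in a step. -/
def stepSize : Bool → Ptn → Ptn → ℤ
  | true, m, l => (l.size : ℤ) - m.size
  | false, m, l => (m.size : ℤ) - l.size

/-- The weight of a walk: `Q` for each cell of the last partition, and the exponent of the step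
for each cell moved in a step. -/
def walkWeight (Q : ℤ) : ∀ (s : List (Bool × ℤ)) (m : Ptn), Walk s m → ℤ
  | [], m, _ => Q * m.size
  | a :: s, m, w => a.2 * stepSize a.1 m w.1.1 + walkWeight Q s w.1.1 w.2

/-- The weight of a walk with free starting point. -/
def freeWeight (Q : ℤ) (s : List (Bool × ℤ)) (w : Σ m, Walk s m) : ℤ := walkWeight Q s w.1 w.2

theorem Reduces.sigma {ι : Type} {F F' : ι → Type} {m : ℤ} {A : ∀ i, F i → ℤ}
    {B : ∀ i, F' i → ℤ} (c : ι → ℤ) (h : ∀ i, Reduces m (A i) (B i)) :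
    Reduces m (fun p : Σ i, F i => c p.1 + A p.1 p.2)
      (fun p : Σ i, F' i => c p.1 + B p.1 p.2) := by
  choose E hE using h
  refine ⟨(Equiv.sigmaCongrRight E).trans (Equiv.sigmaProdDistrib F' ℕ).symm, fun p => ?_⟩
  exact (congrArg (c p.1 + ·) (hE p.1 p.2)).trans (add_assoc _ _ _).symm

theorem Reduces.append_left {Q m : ℤ} {s s' : List (Bool × ℤ)}
    (h : ∀ l, Reduces m (walkWeight Q s l) (walkWeight Q s' l)) (p : List (Bool × ℤ)) (l : Ptn) :
    Reduces m (walkWeight Q (p ++ s) l) (walkWeight Q (p ++ s') l) := by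
  induction p generalizing l with
  | nil => exact h l
  | cons a p ih =>
    exact Reduces.sigma (fun n : {n // Step a.1 l n} => a.2 * stepSize a.1 l n.1)
      fun n => ih n.1

theorem Reduces.freeWeight_append_left {Q m : ℤ} {s s' : List (Bool × ℤ)}
    (h : ∀ l, Reduces m (walkWeight Q s l) (walkWeight Q s' l)) (p : List (Bool × ℤ)) :
    Reduces m (freeWeight Q (p ++ s)) (freeWeight Q (p ++ s')) := by
  have h' := Reduces.sigma (fun _ : Ptn => 0) (Reduces.append_left h p)
  simp only [zero_add] at h'
  exact h'

theorem reduces_swap (Q e e' : ℤ) (s : List (Bool × ℤ)) (m : Ptn) :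
    Reduces (e + e') (walkWeight Q ((true, e) :: (false, e') :: s) m)
      (walkWeight Q ((false, e') :: (true, e) :: s) m) := by
  refine ⟨⟨fun w =>
    let t := toggle m w.2.1.1 ⟨w.1.1, w.1.2, w.2.1.2⟩
    (⟨⟨t.1.1, t.1.2.1⟩, ⟨w.2.1.1, t.1.2.2⟩, w.2.2⟩, t.2), fun w =>
    let t := (toggle m w.1.2.1.1).symm (⟨w.1.1.1, w.1.1.2, w.1.2.1.2⟩, w.2)
    ⟨⟨t.1, t.2.1⟩, ⟨w.1.2.1.1, t.2.2⟩, w.1.2.2⟩, ?_, ?_⟩, ?_⟩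
  · rintro ⟨l, n, w⟩
    exact congrArg (fun t : {l // HStrip m l ∧ HStrip n.1 l} =>
      (⟨⟨t.1, t.2.1⟩, ⟨n.1, t.2.2⟩, w⟩ : Walk ((true, e) :: (false, e') :: s) m))
      ((toggle m n.1).symm_apply_apply ⟨l.1, l.2, n.2⟩)
  · rintro ⟨⟨l, n, w⟩, j⟩
    exact congrArg (fun t : {l // HStrip l m ∧ HStrip l n.1} × ℕ =>
      ((⟨⟨t.1.1, t.1.2.1⟩, ⟨n.1, t.1.2.2⟩, w⟩, t.2) :
        Walk ((false, e') :: (true, e) :: s) m × ℕ))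
      ((toggle m n.1).apply_symm_apply (⟨l.1, l.2, n.2⟩, j))
  · rintro ⟨l, n, w⟩
    have := size_add_size_toggle m n.1 ⟨l.1, l.2, n.2⟩
    zify at this
    simp only [walkWeight, stepSize]
    linear_combination (e + e') * this

theorem reduces_left (Q e : ℤ) (s : List (Bool × ℤ)) :
    Reduces e (freeWeight Q ((false, e) :: s)) (freeWeight Q ((true, e) :: s)) := by
  refine ⟨⟨fun w =>
    let t := toggle w.2.1.1 w.2.1.1 ⟨w.1, w.2.1.2, w.2.1.2⟩
    (⟨t.1.1, ⟨w.2.1.1, t.1.2.1⟩, w.2.2⟩, t.2), fun w =>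
    let t := (toggle w.1.2.1.1 w.1.2.1.1).symm (⟨w.1.1, w.1.2.1.2, w.1.2.1.2⟩, w.2)
    ⟨t.1, ⟨w.1.2.1.1, t.2.1⟩, w.1.2.2⟩, ?_, ?_⟩, ?_⟩
  · rintro ⟨l, n, w⟩
    exact congrArg (fun t : {l // HStrip n.1 l ∧ HStrip n.1 l} =>
      (⟨t.1, ⟨n.1, t.2.1⟩, w⟩ : Σ m, Walk ((false, e) :: s) m))
      ((toggle n.1 n.1).symm_apply_apply ⟨l, n.2, n.2⟩)
  · rintro ⟨⟨l, n, w⟩, j⟩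
    exact congrArg (fun t : {l // HStrip l n.1 ∧ HStrip l n.1} × ℕ =>
      ((⟨t.1.1, ⟨n.1, t.1.2.1⟩, w⟩, t.2) : (Σ m, Walk ((true, e) :: s) m) × ℕ))
      ((toggle n.1 n.1).apply_symm_apply (⟨l, n.2, n.2⟩, j))
  · rintro ⟨l, n, w⟩
    have := size_add_size_toggle n.1 n.1 ⟨l, n.2, n.2⟩
    zify at this
    simp only [freeWeight, walkWeight, stepSize, Equiv.coe_fn_mk]
    linear_combination e * this

theorem reduces_right (Q e : ℤ) (m : Ptn) :
    Reduces (Q + e) (walkWeight Q [(true, e)] m) (walkWeight Q [(false, 2 * Q + e)] m) := by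
  refine ⟨⟨fun w =>
    let t := toggle m m ⟨w.1.1, w.1.2, w.1.2⟩
    (⟨⟨t.1.1, t.1.2.1⟩, w.2⟩, t.2), fun w =>
    let t := (toggle m m).symm (⟨w.1.1.1, w.1.1.2, w.1.1.2⟩, w.2)
    ⟨⟨t.1, t.2.1⟩, w.1.2⟩, ?_, ?_⟩, ?_⟩
  · rintro ⟨l, w⟩
    exact congrArg (fun t : {l // HStrip m l ∧ HStrip m l} =>
      (⟨⟨t.1, t.2.1⟩, w⟩ : Walk [(true, e)] m))
      ((toggle m m).symm_apply_apply ⟨l.1, l.2, l.2⟩)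
  · rintro ⟨⟨l, w⟩, j⟩
    exact congrArg (fun t : {l // HStrip l m ∧ HStrip l m} × ℕ =>
      ((⟨⟨t.1.1, t.1.2.1⟩, w⟩, t.2) : Walk [(false, 2 * Q + e)] m × ℕ))
      ((toggle m m).apply_symm_apply (⟨l.1, l.2, l.2⟩, j))
  · rintro ⟨l, w⟩
    have := size_add_size_toggle m m ⟨l.1, l.2, l.2⟩
    zify at this
    simp only [walkWeight, stepSize]
    linear_combination (Q + e) * this

/-- The generating function of the walks along `s` is `P` times that of the walks along `s'`,
provided that the former have an admissible weight; the latter then have one as well. -/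
def Transfers (Q : ℤ) (P : PowerSeries ℚ) (s s' : List (Bool × ℤ)) : Prop :=
  Admissible (freeWeight Q s) → Admissible (freeWeight Q s') ∧
    weightGF (freeWeight Q s) = P * weightGF (freeWeight Q s')

theorem Transfers.refl (Q : ℤ) (s : List (Bool × ℤ)) : Transfers Q 1 s s :=
  fun h => ⟨h, (one_mul _).symm⟩

theorem Transfers.trans {Q : ℤ} {P P' : PowerSeries ℚ} {s s' s'' : List (Bool × ℤ)}
    (h : Transfers Q P s s') (h' : Transfers Q P' s' s'') : Transfers Q (P * P') s s'' := by
  intro hs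
  obtain ⟨h1, h2⟩ := h hs
  obtain ⟨h3, h4⟩ := h' h1
  exact ⟨h3, by rw [h2, h4, mul_assoc]⟩

theorem Reduces.transfers {Q m : ℤ} {s s' : List (Bool × ℤ)}
    (h : Reduces m (freeWeight Q s) (freeWeight Q s')) (hm : 0 < m) :
    Transfers Q (geomSeries m) s s' :=
  h.weightGF_eq hm

/-- The word of ascending steps with the given exponents. -/
def ups (l : List ℤ) : List (Bool × ℤ) := l.map fun e => (true, e)

/-- A descending step moves to the left end through ascending steps and is reflected there. -/
theorem transfers_moveLeft (Q e : ℤ) (he : 0 < e) (p : List ℤ) (hp : ∀ x ∈ p, 0 < x + e)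
    (S : List (Bool × ℤ)) :
    Transfers Q (geomSeries e * (p.map fun x => geomSeries (x + e)).prod)
      (ups p ++ (false, e) :: S) (ups (e :: p) ++ S) := by
  induction p using List.reverseRecOn generalizing S with
  | nil => simpa [ups] using (reduces_left Q e S).transfers he
  | append_singleton p x ih =>
    have h1 := (Reduces.freeWeight_append_left (reduces_swap Q x e S) (ups p)).transfers
      (hp x (by simp))
    have h2 := h1.trans (ih (fun y hy => hp y (by simp [hy])) ((true, x) :: S))
    convert h2 using 1
    · simp only [List.map_append, List.prod_append, List.map_cons, List.map_nil, List.prod_singleton]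
      ring
    · simp [ups]
    · simp [ups]

/-- The last ascending step is reflected at the right end, moves to the left end and is reflected
there. -/
theorem transfers_rotate (Q x : ℤ) (p : List ℤ) (hx : 0 < Q + x) (hx' : 0 < 2 * Q + x)
    (hp : ∀ y ∈ p, 0 < 2 * Q + y + x) :
    Transfers Q (geomSeries (Q + x) * geomSeries (2 * Q + x) *
        (p.map fun y => geomSeries (2 * Q + y + x)).prod)
      (ups (p ++ [x])) (ups ((2 * Q + x) :: p)) := by
  have h1 := (Reduces.freeWeight_append_left (reduces_right Q x) (ups p)).transfers hx
  have h2 := h1.trans (transfers_moveLeft Q (2 * Q + x) hx' p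
    (fun y hy => by have := hp y hy; linarith) [])
  convert h2 using 1
  · rw [mul_assoc]
    congr 4
    ext y : 1
    congr 1
    ring
  · simp [ups]
  · simp

/-- `∏_{i<j} (1 - z ^ (c + l_i + l_j))⁻¹` -/
noncomputable def pairProd (c : ℤ) : List ℤ → PowerSeries ℚ
  | [] => 1
  | x :: l => (l.map fun y => geomSeries (c + x + y)).prod * pairProd c l

theorem pairProd_append_singleton (c : ℤ) (l : List ℤ) (x : ℤ) :
    pairProd c (l ++ [x]) = pairProd c l * (l.map fun y => geomSeries (c + y + x)).prod := by
  induction l with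
  | nil => simp [pairProd]
  | cons a l ih =>
    simp only [List.cons_append, pairProd, ih, List.map_append, List.prod_append, List.map_cons,
      List.map_nil, List.prod_cons, List.prod_nil]
    ring

theorem List.Perm.pairProd_eq {l l' : List ℤ} (h : l.Perm l') (c : ℤ) :
    pairProd c l = pairProd c l' := by
  induction h with
  | nil => rfl
  | cons x h ih => simp only [pairProd, ih, (h.map _).prod_eq]
  | swap x y l =>
    simp only [pairProd, List.map_cons, List.prod_cons, add_right_comm c x y]
    ring
  | trans _ _ h1 h2 => exact h1.trans h2

theorem pairProd_map_add (c a : ℤ) (l : List ℤ) :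
    pairProd c (l.map (a + ·)) = pairProd (c + 2 * a) l := by
  induction l with
  | nil => rfl
  | cons x l ih =>
    simp only [List.map_cons, pairProd, ih, List.map_map]
    congr 3
    ext y : 1
    simp only [Function.comp]
    congr 1
    ring

/-- `Φ` evaluated at the alphabet of the monomials `z ^ (c + x)` for `x` in `l` -/
noncomputable def phiList (c : ℤ) (l : List ℤ) : PowerSeries ℚ :=
  (l.map fun x => geomSeries (c + x)).prod * pairProd (2 * c) l

theorem phiList_map_add (c a : ℤ) (l : List ℤ) :
    phiList c (l.map (a + ·)) = phiList (c + a) l := by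
  simp only [phiList, pairProd_map_add, List.map_map, mul_add]
  congr 3
  ext y : 1
  simp [add_assoc]

theorem transfers_rotate_append (Q : ℤ) (hQ : 0 < Q) (r d : List ℤ) (hr : ∀ x ∈ r, 0 < Q + x)
    (hd : ∀ x ∈ d, 0 < Q + x) :
    Transfers Q ((r.map fun x => geomSeries (Q + x)).prod *
        (r.map fun x => geomSeries (2 * Q + x)).prod *
        pairProd (2 * Q) r * pairProd (4 * Q) r *
        (r.map fun x => (d.map fun y => geomSeries (2 * Q + y + x)).prod).prod)
      (ups (d ++ r)) (ups (r.map (2 * Q + ·) ++ d)) := by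
  induction r using List.reverseRecOn generalizing d with
  | nil => simpa [pairProd] using Transfers.refl Q (ups d)
  | append_singleton r x ih =>
    have hx := hr x (by simp)
    have hr' : ∀ y ∈ r, 0 < Q + y := fun y hy => hr y (by simp [hy])
    have h1 := transfers_rotate Q x (d ++ r) hx (by linarith) (by
      intro y hy
      rcases List.mem_append.1 hy with hy | hy
      · linarith [hd y hy]
      · linarith [hr' y hy])
    have h2 := h1.trans (ih ((2 * Q + x) :: d) hr' (by
      intro y hy
      rcases List.mem_cons.1 hy with rfl | hy
      · linarith
      · exact hd y hy))
    convert h2 using 1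
    · simp only [List.map_append, List.prod_append, List.map_cons, List.map_nil, List.prod_cons,
        List.prod_nil, mul_one, pairProd_append_singleton, List.prod_map_mul]
      have : ∀ y : ℤ, 2 * Q + (2 * Q + x) + y = 4 * Q + y + x := fun y => by ring
      simp only [this]
      ring
    · simp
    · simp

theorem transfers_phiList (Q : ℤ) (hQ : 0 < Q) (l : List ℤ) (hl : ∀ x ∈ l, 0 < Q + x) (K : ℕ) :
    Transfers Q (∏ k ∈ Finset.range (2 * K), phiList (Q * (k + 1)) l) (ups l)
      (ups (l.map (2 * Q * K + ·))) := by
  induction K with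
  | zero => simpa using Transfers.refl Q (ups l)
  | succ K ih =>
    have h := transfers_rotate_append Q hQ (l.map (2 * Q * K + ·)) [] (by
      intro x hx
      obtain ⟨y, hy, rfl⟩ := List.mem_map.1 hx
      have := hl y hy
      have : 0 ≤ 2 * Q * K := by positivity
      linarith) (by simp)
    convert ih.trans h using 1
    · have hc : (2 * (K + 1)) = 2 * K + 1 + 1 := by ring
      rw [hc, Finset.prod_range_succ, Finset.prod_range_succ, mul_assoc]
      congr 1
      push_cast
      rw [show Q * (2 * (K : ℤ) + 1) = Q + 2 * Q * K by ring,
        show Q * (2 * (K : ℤ) + 1 + 1) = 2 * Q + 2 * Q * K by ring,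
        ← phiList_map_add, ← phiList_map_add, phiList, phiList,
        show 2 * (2 * Q) = 4 * Q by ring]
      simp only [List.map_nil, List.prod_nil, List.map_const', List.prod_replicate, one_pow,
        mul_one]
      ring
    · simp only [List.append_nil, List.map_map]
      congr 2
      ext x
      simp only [Function.comp]
      push_cast
      ring

theorem List.Perm.prod_map_eq_prod_range {p : List ℤ} {n : ℕ} {e : ℕ → ℤ}
    (h : p.Perm ((List.range n).map e)) (g : ℤ → PowerSeries ℚ) :
    (p.map g).prod = ∏ i ∈ Finset.range n, g (e i) := by
  rw [(h.map g).prod_eq, List.map_map]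
  rfl

theorem pairProd_map_range (c : ℤ) (n : ℕ) (e : ℕ → ℤ) :
    pairProd c ((List.range n).map e) =
      ∏ j ∈ Finset.range n, ∏ i ∈ Finset.range j, geomSeries (c + e i + e j) := by
  induction n with
  | zero => rfl
  | succ n ih =>
    rw [List.range_succ, List.map_append, List.map_singleton, pairProd_append_singleton, ih,
      Finset.prod_range_succ,
      (List.Perm.refl _).prod_map_eq_prod_range (fun y => geomSeries (c + y + e n))]

theorem List.Perm.phiList_eq {p : List ℤ} {n : ℕ} {e : ℕ → ℤ}
    (h : p.Perm ((List.range n).map e)) (c : ℤ) :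
    phiList c p = (∏ i ∈ Finset.range n, geomSeries (c + e i)) *
      ∏ j ∈ Finset.range n, ∏ i ∈ Finset.range j, geomSeries (2 * c + e i + e j) := by
  rw [phiList, h.prod_map_eq_prod_range (fun x => geomSeries (c + x)), h.pairProd_eq,
    pairProd_map_range]

/-- All descending steps of a word are turned into ascending ones. -/
theorem exists_transfers_ups (Q : ℤ) (b : ℕ → Bool) (e : ℕ → ℤ) (n : ℕ)
    (h1 : ∀ j < n, b j = false → 0 < e j)
    (h2 : ∀ j < n, b j = false → ∀ i < j, 0 < e i + e j) (S : List (Bool × ℤ)) :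
    ∃ p : List ℤ, p.Perm ((List.range n).map e) ∧
      Transfers Q (∏ j ∈ Finset.range n, if b j then 1 else
          geomSeries (e j) * ∏ i ∈ Finset.range j, geomSeries (e i + e j))
        ((List.range n).map (fun i => (b i, e i)) ++ S) (ups p ++ S) := by
  induction n generalizing S with
  | zero => exact ⟨[], .refl _, by simpa [ups] using Transfers.refl Q S⟩
  | succ n ih =>
    obtain ⟨p, hp, hT⟩ := ih (fun j hj => h1 j (by omega)) (fun j hj => h2 j (by omega))
      ((b n, e n) :: S)
    simp only [List.range_succ, List.map_append, List.map_singleton, List.append_assoc,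
      List.singleton_append, Finset.prod_range_succ]
    cases hb : b n with
    | true =>
      rw [hb] at hT
      exact ⟨p ++ [e n], hp.append_right _, by simpa [ups] using hT⟩
    | false =>
      rw [hb] at hT
      refine ⟨e n :: p, (hp.cons _).trans (List.perm_append_singleton _ _).symm, ?_⟩
      have h := hT.trans (transfers_moveLeft Q (e n) (h1 n (by omega) hb) p (by
        intro x hx
        obtain ⟨i, hi, rfl⟩ := List.mem_map.1 (hp.mem_iff.1 hx)
        exact h2 n (by omega) hb i (List.mem_range.1 hi)) S)
      rwa [hp.prod_map_eq_prod_range (fun x => geomSeries (x + e n))] at h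

/-- The constant walk along ascending steps. -/
def constWalk : ∀ (l : List ℤ) (m : Ptn), Walk (ups l) m
  | [], _ => ()
  | _ :: l, m => ⟨⟨m, HStrip.refl m⟩, constWalk l m⟩

theorem walkWeight_constWalk (Q : ℤ) (l : List ℤ) (m : Ptn) :
    walkWeight Q (ups l) m (constWalk l m) = Q * m.size := by
  induction l with
  | nil => rfl
  | cons x l ih =>
    refine Eq.trans ?_ ih
    change x * ((m.size : ℤ) - m.size) + walkWeight Q (ups l) m (constWalk l m) = _
    rw [sub_self, mul_zero, zero_add]

theorem eq_constWalk_or_le (Q N : ℤ) (hQ : 0 ≤ Q) (hN : 0 ≤ N) (l : List ℤ)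
    (hl : ∀ x ∈ l, N ≤ x) (m : Ptn) (w : Walk (ups l) m) :
    w = constWalk l m ∨ N + Q * m.size ≤ walkWeight Q (ups l) m w := by
  induction l generalizing m with
  | nil => exact Or.inl rfl
  | cons x l ih =>
    have hx := hl x (by simp)
    obtain ⟨⟨k, hk⟩, w⟩ := w
    have hmk : m.size ≤ k.size := HStrip.size_le hk
    have hval : walkWeight Q (ups (x :: l)) m ⟨⟨k, hk⟩, w⟩ =
      x * ((k.size : ℤ) - m.size) + walkWeight Q (ups l) k w := rfl
    have hQk : Q * m.size ≤ Q * k.size := mul_le_mul_of_nonneg_left (by exact_mod_cast hmk) hQ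
    rw [hval]
    rcases hmk.eq_or_lt with heq | hlt
    · obtain rfl := HStrip.eq_of_size_le hk heq.ge
      rcases ih (fun y hy => hl y (by simp [hy])) m w with rfl | h
      · exact Or.inl rfl
      · exact Or.inr (by simpa using h)
    · right
      have hge : Q * k.size ≤ walkWeight Q (ups l) k w := by
        rcases ih (fun y hy => hl y (by simp [hy])) k w with rfl | h
        · rw [walkWeight_constWalk]
        · linarith
      have : x ≤ x * ((k.size : ℤ) - m.size) :=
        le_mul_of_one_le_right (hN.trans hx) (by omega)
      linarith

/-- Steps with large exponents are invisible in low degree. -/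
theorem coeff_weightGF_ups (Q : ℤ) (hQ : 0 ≤ Q) (l : List ℤ) (n : ℕ)
    (hl : ∀ x ∈ l, (n : ℤ) < x) :
    (weightGF (freeWeight Q (ups l))).coeff n =
      (weightGF fun m : Ptn => Q * (m.size : ℤ)).coeff n := by
  simp only [weightGF, PowerSeries.coeff_mk]
  refine congrArg _ (Nat.card_congr (Equiv.ofBijective
    (fun m => ⟨⟨m.1, constWalk l m.1⟩, (walkWeight_constWalk Q l m.1).trans m.2⟩)
    ⟨fun a b h => ?_, ?_⟩).symm)
  · exact Subtype.ext (congrArg (fun t => t.1.1) h)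
  · rintro ⟨⟨m, w⟩, hw⟩
    have hw' : walkWeight Q (ups l) m w = n := hw
    rcases eq_constWalk_or_le Q (n + 1) hQ (by positivity) l hl m w with rfl | h
    · exact ⟨⟨m, (walkWeight_constWalk Q l m).symm.trans hw⟩, rfl⟩
    · have : 0 ≤ Q * (m.size : ℤ) := by positivity
      linarith

/-- Removing the columns of height `m + 1` from a partition with at most `m + 1` parts. -/
noncomputable def removeColumns (m : ℕ) :
    {l : Ptn // l.part (m + 1) = 0} ≃ {l : Ptn // l.part m = 0} × ℕ where
  toFun l := (⟨Ptn.ofParts (fun i => l.1.part i - l.1.part m)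
      (fun i => by have := l.1.part_anti (Nat.le_add_right i 1); omega) m
      (fun i hi => by have := l.1.part_anti hi; omega), by simp⟩, l.1.part m)
  invFun p := ⟨Ptn.ofParts (fun i => if i ≤ m then p.1.1.part i + p.2 else 0)
      (fun i => by
        have := p.1.1.part_anti (Nat.le_add_right i 1)
        split_ifs <;> omega) (m + 1) (fun i hi => by rw [if_neg (by omega)]), by simp⟩
  left_inv l := by
    refine Subtype.ext (Ptn.ext fun i => ?_)
    simp only [Ptn.part_ofParts]
    split_ifs with hi
    · have := l.1.part_anti hi; omega
    · have := l.1.part_anti (show m + 1 ≤ i by omega); have := l.2; omega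
  right_inv p := by
    have h := p.1.2
    refine Prod.ext (Subtype.ext (Ptn.ext fun i => ?_)) ?_
    · simp only [Ptn.part_ofParts, h, le_refl, if_true]
      split_ifs with hi
      · simp
      · have := p.1.1.part_anti (show m ≤ i by omega); omega
    · simp [h]

theorem size_removeColumns (m : ℕ) (l : {l : Ptn // l.part (m + 1) = 0}) :
    l.1.size = (removeColumns m l).1.1.size + (m + 1) * (removeColumns m l).2 := by
  have h0 : ∀ i, m + 1 ≤ i → l.1.part i = 0 := fun i hi => by
    have := l.1.part_anti hi; have := l.2; omega
  have h1 : ∀ i, m + 1 ≤ i → (removeColumns m l).1.1.part i = 0 := fun i hi => by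
    have := (removeColumns m l).1.1.part_anti hi
    have := (removeColumns m l).1.1.part_anti (Nat.le_add_right m 1)
    have := (removeColumns m l).1.2; omega
  rw [l.1.size_eq_sum h0, Ptn.size_eq_sum _ h1]
  have : ∀ i ∈ Finset.range (m + 1),
      l.1.part i = (removeColumns m l).1.1.part i + (removeColumns m l).2 := fun i hi => by
    have := l.1.part_anti (Nat.lt_succ_iff.1 (Finset.mem_range.1 hi))
    simp only [removeColumns, Equiv.coe_fn_mk, Ptn.part_ofParts]
    omega
  rw [Finset.sum_congr rfl this, Finset.sum_add_distrib]
  simp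

theorem admissible_size (Q : ℤ) (hQ : 0 < Q) : Admissible fun m : Ptn => Q * (m.size : ℤ) where
  nonneg m := by positivity
  finite n := by
    refine Finite.of_injective (β := {l : Ptn // l.size ≤ n.toNat})
      (fun m => ⟨m.1, ?_⟩) fun a b h => Subtype.ext (congrArg (fun t => t.1) h)
    have h := m.2
    have : (m.1.size : ℤ) ≤ Q * m.1.size := le_mul_of_one_le_left (by positivity) hQ
    omega

theorem weightGF_bounded (Q : ℤ) (hQ : 0 < Q) (m : ℕ) :
    weightGF (fun l : {l : Ptn // l.part m = 0} => Q * (l.1.size : ℤ)) =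
      ∏ k ∈ Finset.range m, geomSeries (Q * (k + 1)) := by
  induction m with
  | zero =>
    have hz : ∀ l : {l : Ptn // l.part 0 = 0}, l.1.size = 0 := fun l => by
      rw [l.1.size_eq_sum (N := 0) fun i hi => by
        have := l.1.part_anti hi; have := l.2; omega]
      rfl
    have hsub : Subsingleton {l : Ptn // l.part 0 = 0} := ⟨fun a b => Subtype.ext (Ptn.ext
      fun i => by
        rw [a.1.part_eq_zero_of_size_le (by rw [hz]; omega),
          b.1.part_eq_zero_of_size_le (by rw [hz]; omega)])⟩
    let l0 : {l : Ptn // l.part 0 = 0} :=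
      ⟨Ptn.ofParts (fun _ => 0) (fun _ => le_rfl) 0 fun _ _ => rfl, rfl⟩
    ext n
    simp only [weightGF, PowerSeries.coeff_mk, hz, Finset.range_zero, Finset.prod_empty,
      PowerSeries.coeff_one]
    split_ifs with hn
    · subst hn
      have : Unique {l : {l : Ptn // l.part 0 = 0} // Q * ((0 : ℕ) : ℤ) = ((0 : ℕ) : ℤ)} :=
        { default := ⟨l0, by simp⟩, uniq := fun a => Subtype.ext (hsub.elim _ _) }
      rw [Nat.card_unique, Nat.cast_one]
    · have : IsEmpty {l : {l : Ptn // l.part 0 = 0} // Q * ((0 : ℕ) : ℤ) = (n : ℤ)} :=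
        ⟨fun a => hn (by have := a.2; simp at this; omega)⟩
      rw [Nat.card_of_isEmpty, Nat.cast_zero]
  | succ m ih =>
    have hred : Reduces (Q * (m + 1))
        (fun l : {l : Ptn // l.part (m + 1) = 0} => Q * (l.1.size : ℤ))
        (fun l : {l : Ptn // l.part m = 0} => Q * (l.1.size : ℤ)) :=
      ⟨removeColumns m, fun l => by
        simp only [size_removeColumns m l]
        push_cast
        ring⟩
    rw [(hred.weightGF_eq (by positivity) ((admissible_size Q hQ).of_injective Subtype.val
      Subtype.val_injective fun _ => rfl)).2, ih, Finset.prod_range_succ, mul_comm]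

theorem coeff_weightGF_size (Q : ℤ) (hQ : 0 < Q) {n m : ℕ} (h : n ≤ m) :
    (weightGF fun l : Ptn => Q * (l.size : ℤ)).coeff n =
      (∏ k ∈ Finset.range m, geomSeries (Q * (k + 1))).coeff n := by
  rw [← weightGF_bounded Q hQ]
  simp only [weightGF, PowerSeries.coeff_mk]
  refine congrArg _ (Nat.card_congr ⟨fun l => ⟨⟨l.1, ?_⟩, l.2⟩, fun l => ⟨l.1.1, l.2⟩,
    fun _ => rfl, fun _ => rfl⟩)
  have : (l.1.size : ℤ) ≤ Q * l.1.size := le_mul_of_one_le_left (by positivity) hQ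
  have := l.2
  exact l.1.part_eq_zero_of_size_le (by omega)

/-- The sequence of partitions visited by a walk. -/
def walkSeq : ∀ (s : List (Bool × ℤ)) (m : Ptn), Walk s m → ℕ → Ptn
  | [], m, _, _ => m
  | _ :: _, m, _, 0 => m
  | _ :: s, _, w, n + 1 => walkSeq s w.1.1 w.2 n

theorem walkSeq_zero (s : List (Bool × ℤ)) (m : Ptn) (w : Walk s m) : walkSeq s m w 0 = m := by
  cases s <;> rfl

theorem step_walkSeq (s : List (Bool × ℤ)) (m : Ptn) (w : Walk s m) (i : ℕ)
    (hi : i < s.length) : Step s[i].1 (walkSeq s m w i) (walkSeq s m w (i + 1)) := by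
  induction s generalizing m i with
  | nil => simp at hi
  | cons a s ih =>
    cases i with
    | zero =>
      have := w.1.2
      change Step a.1 m (walkSeq s w.1.1 w.2 0)
      rwa [walkSeq_zero]
    | succ i => exact ih w.1.1 w.2 i (by simpa using hi)

theorem walkSeq_injective (s : List (Bool × ℤ)) (m : Ptn) (w w' : Walk s m)
    (h : ∀ i ≤ s.length, walkSeq s m w i = walkSeq s m w' i) : w = w' := by
  induction s generalizing m with
  | nil => rfl
  | cons a s ih =>
    obtain ⟨⟨l, hl⟩, w⟩ := w
    obtain ⟨⟨l', hl'⟩, w'⟩ := w'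
    have h' : ∀ i ≤ s.length, walkSeq s l w i = walkSeq s l' w' i := fun i hi =>
      h (i + 1) (by simpa using hi)
    obtain rfl : l = l' := by simpa [walkSeq_zero] using h' 0 (by omega)
    rw [ih l w w' h']

theorem exists_walkSeq_eq (s : List (Bool × ℤ)) (L : ℕ → Ptn)
    (hL : ∀ (i : ℕ) (hi : i < s.length), Step s[i].1 (L i) (L (i + 1))) :
    ∃ w : Walk s (L 0), ∀ i ≤ s.length, walkSeq s _ w i = L i := by
  induction s generalizing L with
  | nil => exact ⟨(), fun i hi => by
    obtain rfl : i = 0 := (by simpa using hi)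
    rfl⟩
  | cons a s ih =>
    obtain ⟨w, hw⟩ := ih (fun i => L (i + 1)) fun i hi => hL (i + 1) (by simpa using hi)
    refine ⟨⟨⟨L 1, hL 0 (by simp)⟩, w⟩, fun i hi => ?_⟩
    cases i with
    | zero => rfl
    | succ i => exact hw i (by simpa using hi)

theorem walkWeight_eq_sum (Q : ℤ) (s : List (Bool × ℤ)) (m : Ptn) (w : Walk s m)
    (f : ℕ → Bool × ℤ) (hf : ∀ (i : ℕ) (hi : i < s.length), s[i] = f i) :
    walkWeight Q s m w = Q * (walkSeq s m w s.length).size +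
      ∑ i ∈ Finset.range s.length,
        (f i).2 * stepSize (f i).1 (walkSeq s m w i) (walkSeq s m w (i + 1)) := by
  induction s generalizing m f with
  | nil => simp [walkWeight, walkSeq]
  | cons a s ih =>
    have h0 : a = f 0 := hf 0 (by simp)
    have h1 := ih w.1.1 w.2 (fun i => f (i + 1)) fun i hi => hf (i + 1) (by simpa using hi)
    rw [List.length_cons, Finset.sum_range_succ', ← h0]
    simp only [walkWeight, walkSeq, walkSeq_zero, h1]
    ring

/-- The direction of the step `λ^i, λ^{i+1}` of a symmetric cylindric partition. -/
def profileDir (δ : ℕ → ℤ) (i : ℕ) : Bool := decide (δ (i + 1) = 1)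

/-- The exponent of the variable of the step `λ^i, λ^{i+1}`, when the size is expressed by the
last partition and the sizes of the steps. -/
def profileExp (δ : ℕ → ℤ) (i : ℕ) : ℤ := if δ (i + 1) = 1 then -(2 * i + 1) else 2 * i + 1

/-- The word of steps given by a profile. -/
def profileWord (h : ℕ) (δ : ℕ → ℤ) : List (Bool × ℤ) :=
  (List.range h).map fun i => (profileDir δ i, profileExp δ i)

theorem length_profileWord (h : ℕ) (δ : ℕ → ℤ) : (profileWord h δ).length = h := by
  simp [profileWord]

theorem step_profileDir {δ : ℕ → ℤ} {i : ℕ} {m l : Ptn} :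
    Step (profileDir δ i) m l ↔ if δ (i + 1) = 1 then HStrip m l else HStrip l m := by
  by_cases h : δ (i + 1) = 1 <;> simp [profileDir, h, Step]

theorem step_walkSeq_profileWord (h : ℕ) (δ : ℕ → ℤ) (m : Ptn) (w : Walk (profileWord h δ) m)
    {i : ℕ} (hi : i < h) : if δ (i + 1) = 1
      then HStrip (walkSeq _ m w i) (walkSeq _ m w (i + 1))
      else HStrip (walkSeq _ m w (i + 1)) (walkSeq _ m w i) := by
  have := step_walkSeq _ m w i (by rwa [length_profileWord])
  rw [← step_profileDir]
  simpa [profileWord] using this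

theorem walkWeight_profileWord (h : ℕ) (δ : ℕ → ℤ) (m : Ptn) (w : Walk (profileWord h δ) m) :
    walkWeight (2 * h + 1) _ m w = (walkSeq _ m w 0).size +
      2 * ∑ i ∈ Finset.range h, ((walkSeq _ m w (i + 1)).size : ℤ) := by
  have telescope : ∀ (a : ℕ → ℤ) (n : ℕ), (2 * n + 1) * a n +
      ∑ i ∈ Finset.range n, -(2 * (i : ℤ) + 1) * (a (i + 1) - a i) =
        a 0 + 2 * ∑ i ∈ Finset.range n, a (i + 1) := by
    intro a n
    induction n with
    | zero => simp
    | succ n ih =>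
      rw [Finset.sum_range_succ, Finset.sum_range_succ, mul_add, ← add_assoc (a 0), ← ih]
      push_cast
      ring
  rw [walkWeight_eq_sum _ _ _ _ (fun i => (profileDir δ i, profileExp δ i))
    (by simp [profileWord]), length_profileWord,
    ← telescope fun i => ((walkSeq _ m w i).size : ℤ)]
  congr 1
  refine Finset.sum_congr rfl fun i _ => ?_
  by_cases hi : δ (i + 1) = 1 <;> simp [profileDir, profileExp, hi, stepSize]
  ring

/-- The palindromic sequence obtained by unfolding a walk. -/
def unfold (h : ℕ) (δ : ℕ → ℤ) (w : Σ m, Walk (profileWord h δ) m) (k : Fin (2 * h + 1)) : Ptn :=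
  walkSeq _ w.1 w.2 ((k - h) + (h - k))

theorem isSCP_unfold {h : ℕ} {δ : ℕ → ℤ} (hδ : IsProfile h δ)
    (w : Σ m, Walk (profileWord h δ) m) : IsSCP h δ (unfold h δ w) := by
  refine ⟨fun i hi => ?_, fun k => ?_⟩
  · by_cases hih : i + 1 ≤ h
    · obtain ⟨j, rfl⟩ : ∃ j, h = i + 1 + j := ⟨h - (i + 1), by omega⟩
      have hs := step_walkSeq_profileWord _ δ w.1 w.2 (i := j) (by omega)
      have hd : dblProfile (i + 1 + j) δ (i + 1) = -δ (j + 1) := by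
        rw [dblProfile, if_pos hih]
        congr 2
        omega
      have e1 : i - (i + 1 + j) + (i + 1 + j - i) = j + 1 := by omega
      have e2 : i + 1 - (i + 1 + j) + (i + 1 + j - (i + 1)) = j := by omega
      simp only [unfold, hd, e1, e2]
      rcases hδ (j + 1) (by omega) (by omega) with h1 | h1
      · rw [if_pos h1] at hs
        rwa [if_neg (by rw [h1]; norm_num)]
      · rw [if_neg (by rw [h1]; norm_num)] at hs
        rwa [if_pos (by rw [h1]; norm_num)]
    · obtain ⟨j, rfl⟩ : ∃ j, i = h + j := ⟨i - h, by omega⟩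
      have hs := step_walkSeq_profileWord h δ w.1 w.2 (i := j) (by omega)
      have hd : dblProfile h δ (h + j + 1) = δ (j + 1) := by
        rw [dblProfile, if_neg hih]
        congr 1
        omega
      have e1 : h + j - h + (h - (h + j)) = j := by omega
      have e2 : h + j + 1 - h + (h - (h + j + 1)) = j + 1 := by omega
      simp only [unfold, hd, e1, e2]
      exact hs
  · simp only [unfold]
    congr 1
    omega

theorem freeWeight_profileWord (h : ℕ) (δ : ℕ → ℤ) (w : Σ m, Walk (profileWord h δ) m) :
    freeWeight (2 * h + 1) _ w = scpSize h (unfold h δ w) := by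
  rw [freeWeight, walkWeight_profileWord, scpSize, Finset.sum_range]
  push_cast
  have e : ∀ i : ℕ, h + i + 1 - h + (h - (h + i + 1)) = i + 1 := fun i => by omega
  simp [unfold, e]

theorem unfold_bijective {h : ℕ} {δ : ℕ → ℤ} (hδ : IsProfile h δ) :
    Function.Bijective fun w => (⟨unfold h δ w, isSCP_unfold hδ w⟩ :
      {M : Fin (2 * h + 1) → Ptn // IsSCP h δ M}) := by
  refine ⟨?_, ?_⟩
  · rintro ⟨m, w⟩ ⟨m', w'⟩ heq
    have key : ∀ i ≤ h, walkSeq _ m w i = walkSeq _ m' w' i := fun i hi => by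
      have := congrFun (congrArg Subtype.val heq) ⟨h + i, by omega⟩
      have e : h + i - h + (h - (h + i)) = i := by omega
      simpa only [unfold, e] using this
    obtain rfl : m = m' := by simpa [walkSeq_zero] using key 0 (by omega)
    rw [walkSeq_injective _ _ w w' (by rwa [length_profileWord])]
  · rintro ⟨M, hM, hsymm⟩
    obtain ⟨w, hw⟩ := exists_walkSeq_eq (profileWord h δ) (fun i => M ⟨h + min i h, by omega⟩)
      (by
        intro i hi
        rw [length_profileWord] at hi
        have hs := hM (h + i) (by omega)
        have hd : dblProfile h δ (h + i + 1) = δ (i + 1) := by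
          rw [dblProfile, if_neg (by omega)]
          congr 1
          omega
        have e1 : min i h = i := by omega
        have e2 : min (i + 1) h = i + 1 := by omega
        rw [hd] at hs
        have hget : (profileWord h δ)[i].1 = profileDir δ i := by simp [profileWord]
        simp only [hget, step_profileDir, e1, e2]
        exact hs)
    rw [length_profileWord] at hw
    refine ⟨⟨_, w⟩, Subtype.ext (funext fun k => ?_)⟩
    have hk := k.2
    simp only [unfold]
    rw [hw _ (by omega)]
    rcases le_total h k with hhk | hhk
    · congr 1
      ext
      simp only
      omega
    · rw [hsymm k]
      congr 1
      ext
      simp only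
      omega

theorem weightGF_scpSize {h : ℕ} {δ : ℕ → ℤ} (hδ : IsProfile h δ) :
    weightGF (fun ω : {M : Fin (2 * h + 1) → Ptn // IsSCP h δ M} => (scpSize h ω.1 : ℤ)) =
      weightGF (freeWeight (2 * h + 1) (profileWord h δ)) :=
  (weightGF_congr (Equiv.ofBijective _ (unfold_bijective hδ)) (freeWeight_profileWord h δ)).symm

theorem admissible_scpSize (h : ℕ) (δ : ℕ → ℤ) :
    Admissible (fun ω : {M : Fin (2 * h + 1) → Ptn // IsSCP h δ M} => (scpSize h ω.1 : ℤ)) where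
  nonneg _ := by positivity
  finite n := by
    have hb : ∀ ω : {ω : {M : Fin (2 * h + 1) → Ptn // IsSCP h δ M} // (scpSize h ω.1 : ℤ) = n},
        ∀ k : Fin (h + 1), (ω.1.1 ⟨h + k, by omega⟩).size ≤ n.toNat := by
      rintro ⟨⟨M, hM⟩, hn⟩ k
      simp only [scpSize] at hn
      have hsum := fun i : Fin h => Finset.single_le_sum (s := Finset.univ)
        (f := fun i : Fin h => (M ⟨h + (i : ℕ) + 1, by omega⟩).size) (fun _ _ => Nat.zero_le _)
        (Finset.mem_univ i)
      obtain ⟨_ | k, hk⟩ := k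
      · simp only [add_zero]
        omega
      · have := hsum ⟨k, by omega⟩
        simp only [← add_assoc] at this ⊢
        omega
    refine Finite.of_injective (β := Fin (h + 1) → {l : Ptn // l.size ≤ n.toNat})
      (fun ω k => ⟨_, hb ω k⟩) fun a b hab => Subtype.ext (Subtype.ext (funext fun k => ?_))
    have key : ∀ k : Fin (2 * h + 1), h ≤ k → a.1.1 k = b.1.1 k := fun k hk => by
      have := congrArg Subtype.val (congrFun hab ⟨k - h, by omega⟩)
      simpa only [Nat.add_sub_cancel' hk] using this
    rcases le_total h k with hk | hk
    · exact key k hk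
    · rw [a.1.2.2 k, b.1.2.2 k]
      exact key _ (by simp only; omega)

theorem tsum_z_pow {T : Type} (w : T → ℕ) (hw : Admissible fun t => (w t : ℤ)) :
    ∑' t, z ^ w t = weightGF fun t => (w t : ℤ) := by
  have : T2Space (PowerSeries ℚ) := PowerSeries.WithPiTopology.instT2Space ℚ
  refine HasSum.tsum_eq ((PowerSeries.WithPiTopology.hasSum_iff_hasSum_coeff ℚ).2 fun n => ?_)
  have hfin : {t | w t = n}.Finite := by
    have := hw.finite n
    simp only [Nat.cast_inj] at this
    exact this
  have hcard : Nat.card {t // (w t : ℤ) = n} = hfin.toFinset.card := by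
    simp only [Nat.cast_inj]
    exact Nat.card_eq_card_finite_toFinset hfin
  have hc : ∀ t, (z ^ w t).coeff n = if w t = n then (1 : ℚ) else 0 := fun t => by
    simp [z, PowerSeries.coeff_X_pow, eq_comm]
  have hs := hasSum_sum_of_ne_finset_zero (L := .unconditional T)
    (f := fun t => (z ^ w t).coeff n) (s := hfin.toFinset) fun t ht => by
      rw [hc, if_neg (by simpa using ht)]
  have hn : (weightGF fun t => (w t : ℤ)).coeff n = ∑ t ∈ hfin.toFinset, (z ^ w t).coeff n := by
    simp only [weightGF, PowerSeries.coeff_mk]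
    rw [hcard, Finset.sum_congr rfl fun t ht => (hc t).trans (if_pos (by simpa using ht))]
    simp
  rwa [← hn] at hs

theorem prod_range_filter_lt {M : Type*} [CommMonoid M] {j n : ℕ} (hj : j ≤ n) (f : ℕ → M) :
    ∏ i ∈ Finset.range n, (if i < j then f i else 1) = ∏ i ∈ Finset.range j, f i := by
  rw [← Finset.prod_filter]
  congr 1
  ext i
  simp only [Finset.mem_filter, Finset.mem_range]
  omega

theorem Phi_eq_prod (X : ℕ → PowerSeries ℚ) (n : ℕ) (hX : ∀ i, n ≤ i → X i = 0) :
    Phi X = (∏ i ∈ Finset.range n, (1 - X i)⁻¹) *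
      ∏ j ∈ Finset.range n, ∏ i ∈ Finset.range j, (1 - X i * X j)⁻¹ := by
  have h1 : (1 : PowerSeries ℚ)⁻¹ = 1 := by simp
  rw [Phi, tprod_eq_prod (s := Finset.range n) (fun i hi => by
      rw [hX i (by simpa using hi), sub_zero, h1]),
    tprod_eq_prod (s := (Finset.range n ×ˢ Finset.range n).subtype fun q => q.1 < q.2)
      (fun p hp => by
        have := p.2
        rw [hX p.1.2 (by simp at hp; omega), mul_zero, sub_zero, h1]),
    Finset.prod_subtype_eq_prod_filter (p := fun q : ℕ × ℕ => q.1 < q.2)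
      (f := fun q : ℕ × ℕ => (1 - X q.1 * X q.2)⁻¹), Finset.prod_filter,
    Finset.prod_product_right]
  congr 1
  refine Finset.prod_congr rfl fun j hj => ?_
  exact prod_range_filter_lt (Finset.mem_range.1 hj).le fun i => (1 - X i * X j)⁻¹

theorem geomSeries_eq {m : ℤ} {a : ℕ} (h : m = a) : geomSeries m = (1 - z ^ a)⁻¹ := by
  rw [geomSeries, h, Int.toNat_natCast]

theorem neg_le_profileExp {h i : ℕ} (δ : ℕ → ℤ) (hi : i < h) : -(2 * h - 1 : ℤ) ≤ profileExp δ i := by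
  rw [profileExp]
  split_ifs <;> omega

theorem Phi_eq_phiList {h : ℕ} {δ : ℕ → ℤ} {p : List ℤ}
    (hp : p.Perm ((List.range h).map (profileExp δ))) (k : ℕ) :
    Phi (fun n => if n < h then
        (if δ (n + 1) = 1 then z ^ ((2 * h + 1) * (k + 1) - (2 * (n + 1) - 1))
          else z ^ ((2 * h + 1) * (k + 1) + (2 * (n + 1) - 1)))
      else 0) = phiList ((2 * h + 1) * (k + 1)) p := by
  obtain ⟨c, hc⟩ : ∃ c, c = (2 * h + 1) * (k + 1) := ⟨_, rfl⟩
  have hch : 2 * h + 1 ≤ c := hc ▸ Nat.le_mul_of_pos_right _ (by omega)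
  have hc' : ((2 * h + 1) * (k + 1) : ℤ) = c := by rw [hc]; push_cast; rfl
  rw [← hc, hc', hp.phiList_eq, Phi_eq_prod _ h fun i hi => if_neg (by omega)]
  have hX : ∀ n < h, ∃ a : ℕ, (c : ℤ) + profileExp δ n = a ∧
      (if n < h then (if δ (n + 1) = 1 then z ^ (c - (2 * (n + 1) - 1))
          else z ^ (c + (2 * (n + 1) - 1))) else 0) = z ^ a := fun n hn => by
    rw [if_pos hn, profileExp]
    split_ifs
    · exact ⟨_, by omega, rfl⟩
    · exact ⟨_, by omega, rfl⟩
  congr 1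
  · refine Finset.prod_congr rfl fun i hi => ?_
    obtain ⟨a, ha, hXa⟩ := hX i (Finset.mem_range.1 hi)
    rw [hXa, geomSeries_eq ha]
  · refine Finset.prod_congr rfl fun j hj => Finset.prod_congr rfl fun i hi => ?_
    rw [Finset.mem_range] at hi hj
    obtain ⟨a, ha, hXa⟩ := hX i (hi.trans hj)
    obtain ⟨b, hb, hXb⟩ := hX j hj
    rw [hXa, hXb, ← pow_add, geomSeries_eq (a := a + b) (by push_cast; linarith)]

theorem prod_mul_Phi_eq {h : ℕ} {δ : ℕ → ℤ} (hδ : IsProfile h δ) :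
    (∏ q ∈ ((Finset.Icc 1 h) ×ˢ (Finset.Icc 1 h)).filter
        (fun q => q.1 < q.2 ∧ δ q.1 > δ q.2), (1 - z ^ (2 * (q.2 - q.1)))⁻¹) *
      Phi (fun n => if n < h ∧ δ (n + 1) = -1 then z ^ (2 * (n + 1) - 1) else 0) =
    ∏ j ∈ Finset.range h, if profileDir δ j then 1 else
      geomSeries (profileExp δ j) *
        ∏ i ∈ Finset.range j, geomSeries (profileExp δ i + profileExp δ j) := by
  have h1 : (1 : PowerSeries ℚ)⁻¹ = 1 := by simp
  have hI : Finset.Icc 1 h = Finset.Ico 1 (h + 1) := by ext; simp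
  rw [Phi_eq_prod _ h fun i hi => if_neg (by omega), Finset.prod_filter, hI,
    Finset.prod_product_right]
  simp only [Finset.prod_Ico_eq_prod_range, Nat.add_sub_cancel]
  rw [← Finset.prod_mul_distrib, ← Finset.prod_mul_distrib]
  refine Finset.prod_congr rfl fun j hj => ?_
  rw [Finset.mem_range] at hj
  simp only [add_comm 1, add_lt_add_iff_right, ite_and, hj, if_true]
  rw [prod_range_filter_lt hj.le
    (fun i => if δ (i + 1) > δ (j + 1) then (1 - z ^ (2 * (j + 1 - (i + 1))))⁻¹ else 1)]
  rcases hδ (j + 1) (by omega) (by omega) with hj1 | hj1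
  · rw [if_neg (by rw [hj1]; norm_num), if_pos (by simp [profileDir, hj1]), sub_zero, h1, one_mul,
      ← Finset.prod_mul_distrib]
    refine Finset.prod_eq_one fun i hi => ?_
    rw [Finset.mem_range] at hi
    rcases hδ (i + 1) (by omega) (by omega) with hi1 | hi1 <;> simp [hi1, hj1, h1]
  · have hj2 : ¬ δ (j + 1) = 1 := by rw [hj1]; norm_num
    rw [if_pos hj1, if_neg (by simp [profileDir, hj2]), mul_left_comm, ← Finset.prod_mul_distrib]
    congr 1
    · exact (geomSeries_eq (by rw [profileExp, if_neg hj2]; omega)).symm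
    · refine Finset.prod_congr rfl fun i hi => ?_
      rw [Finset.mem_range] at hi
      have hih : i < h := hi.trans hj
      rw [if_pos hih]
      rcases hδ (i + 1) (by omega) (by omega) with hi1 | hi1
      · rw [if_pos (by rw [hi1, hj1]; norm_num), if_neg (by rw [hi1]; norm_num), zero_mul,
          sub_zero, h1, mul_one]
        refine (geomSeries_eq ?_).symm
        rw [profileExp, profileExp, if_pos hi1, if_neg hj2]
        omega
      · rw [if_neg (by rw [hi1, hj1]; norm_num), if_pos hi1, ← pow_add, one_mul]
        refine (geomSeries_eq ?_).symm
        rw [profileExp, profileExp, if_neg (by rw [hi1]; norm_num), if_neg hj2]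
        omega

theorem X_pow_dvd_mul_sub_one {k : ℕ} {A B : PowerSeries ℚ} (hA : PowerSeries.X ^ k ∣ A - 1)
    (hB : PowerSeries.X ^ k ∣ B - 1) : PowerSeries.X ^ k ∣ A * B - 1 := by
  have : A * B - 1 = (A - 1) * B + (B - 1) := by ring
  rw [this]
  exact dvd_add (hA.mul_right B) hB

theorem X_pow_dvd_geomSeries_sub_one {k : ℕ} {m : ℤ} (h : (k : ℤ) < m) :
    PowerSeries.X ^ k ∣ geomSeries m - 1 := by
  have hi := PowerSeries.mul_inv_cancel _ (constantCoeff_one_sub_z_pow (a := m.toNat) (by omega))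
  have : geomSeries m - 1 = z ^ m.toNat * geomSeries m := by
    rw [geomSeries]
    linear_combination hi
  rw [this]
  exact (pow_dvd_pow _ (by omega)).mul_right _

theorem X_pow_dvd_phiList_mul_sub_one {h : ℕ} {δ : ℕ → ℤ} {p : List ℤ}
    (hp : p.Perm ((List.range h).map (profileExp δ))) (k : ℕ) :
    PowerSeries.X ^ k ∣ phiList ((2 * h + 1) * (k + 1)) p *
      geomSeries ((2 * h + 1) * (k + 1)) - 1 := by
  have hk : (0 : ℤ) ≤ 2 * h * k := by positivity
  rw [hp.phiList_eq]
  refine X_pow_dvd_mul_sub_one (X_pow_dvd_mul_sub_one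
      (Finset.prod_induction _ (fun P => PowerSeries.X ^ k ∣ P - 1)
        (fun _ _ => X_pow_dvd_mul_sub_one) (by simp) fun i hi => ?_)
      (Finset.prod_induction _ (fun P => PowerSeries.X ^ k ∣ P - 1)
        (fun _ _ => X_pow_dvd_mul_sub_one) (by simp) fun j hj =>
        Finset.prod_induction _ (fun P => PowerSeries.X ^ k ∣ P - 1)
          (fun _ _ => X_pow_dvd_mul_sub_one) (by simp) fun i hi => ?_))
    (X_pow_dvd_geomSeries_sub_one (by linarith))
  · have := neg_le_profileExp δ (Finset.mem_range.1 hi)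
    exact X_pow_dvd_geomSeries_sub_one (by linarith)
  · have h1 := neg_le_profileExp δ (Finset.mem_range.1 hj)
    have h2 := neg_le_profileExp δ ((Finset.mem_range.1 hi).trans (Finset.mem_range.1 hj))
    exact X_pow_dvd_geomSeries_sub_one (by linarith)

theorem multipliable_of_X_pow_dvd_sub_one {B : ℕ → PowerSeries ℚ}
    (hB : ∀ k, PowerSeries.X ^ k ∣ B k - 1) : Multipliable B := by
  have h := PowerSeries.WithPiTopology.multipliable_one_add_of_tendsto_order_atTop_nhds_top ℚ
    (f := fun k => B k - 1) (ENat.tendsto_nhds_top_iff_natCast_lt.2 fun n => by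
      filter_upwards [Filter.eventually_gt_atTop n] with k hk
      exact (Nat.cast_lt.2 hk).trans_le
        (PowerSeries.nat_le_order _ _ (PowerSeries.X_pow_dvd_iff.1 (hB k))))
  simp only [add_sub_cancel] at h
  exact h

theorem coeff_mul_congr {A B C : PowerSeries ℚ} {n : ℕ} (h : ∀ m ≤ n, B.coeff m = C.coeff m) :
    (A * B).coeff n = (A * C).coeff n := by
  rw [PowerSeries.coeff_mul, PowerSeries.coeff_mul]
  exact Finset.sum_congr rfl fun x hx => by
    rw [h x.2 (Finset.HasAntidiagonal.mem_antidiagonal.1 hx ▸ Nat.le_add_left _ _)]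

theorem coeff_weightGF_profileWord {h : ℕ} {δ : ℕ → ℤ} (hδ : IsProfile h δ) {p : List ℤ}
    (hp : p.Perm ((List.range h).map (profileExp δ))) {P : PowerSeries ℚ}
    (hP : Transfers (2 * h + 1) P (profileWord h δ) (ups p)) {n K : ℕ} (hK : n < K) :
    (weightGF (freeWeight (2 * h + 1) (profileWord h δ))).coeff n =
      (P * ∏ k ∈ Finset.range (2 * K), phiList ((2 * h + 1) * (k + 1)) p *
        geomSeries ((2 * h + 1) * (k + 1))).coeff n := by
  have hpe : ∀ x ∈ p, -(2 * h - 1 : ℤ) ≤ x := fun x hx => by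
    obtain ⟨i, hi, rfl⟩ := List.mem_map.1 (hp.mem_iff.1 hx)
    exact neg_le_profileExp δ (List.mem_range.1 hi)
  have hadm : Admissible (freeWeight (2 * h + 1) (profileWord h δ)) :=
    (admissible_scpSize h δ).of_injective _ (unfold_bijective hδ).1
      fun w => (freeWeight_profileWord h δ w).symm
  obtain ⟨hadm', hgf⟩ := hP hadm
  obtain ⟨-, hgf'⟩ := transfers_phiList (2 * h + 1) (by positivity) p
    (fun x hx => by linarith [hpe x hx]) K hadm'
  rw [hgf, hgf', Finset.prod_mul_distrib]
  refine coeff_mul_congr fun m hm => coeff_mul_congr fun m' hm' => ?_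
  rw [coeff_weightGF_ups _ (by positivity), coeff_weightGF_size _ (by positivity)]
  · omega
  · intro x hx
    obtain ⟨y, hy, rfl⟩ := List.mem_map.1 hx
    have hmK : (m' : ℤ) + 1 ≤ K := by omega
    have : (0 : ℤ) ≤ h * (K - 1) := mul_nonneg (by positivity) (by omega)
    have := hpe y hy
    nlinarith

theorem weightGF_profileWord {h : ℕ} {δ : ℕ → ℤ} (hδ : IsProfile h δ) {p : List ℤ}
    (hp : p.Perm ((List.range h).map (profileExp δ))) {P : PowerSeries ℚ}
    (hP : Transfers (2 * h + 1) P (profileWord h δ) (ups p)) :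
    weightGF (freeWeight (2 * h + 1) (profileWord h δ)) =
      P * ∏' k : ℕ, phiList ((2 * h + 1) * (k + 1)) p * geomSeries ((2 * h + 1) * (k + 1)) := by
  have : IsTopologicalSemiring (PowerSeries ℚ) :=
    PowerSeries.WithPiTopology.instIsTopologicalSemiring ℚ
  ext n
  have hlim := (multipliable_of_X_pow_dvd_sub_one
    (X_pow_dvd_phiList_mul_sub_one hp)).hasProd.tendsto_prod_nat.comp
      (Filter.tendsto_id.const_mul_atTop' (two_pos (α := ℕ)))
  have hcoeff := ((PowerSeries.WithPiTopology.continuous_coeff ℚ n).tendsto _).comp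
    (hlim.const_mul P)
  refine tendsto_nhds_unique (tendsto_const_nhds.congr' ?_) hcoeff
  filter_upwards [Filter.eventually_gt_atTop n] with K hK
  exact coeff_weightGF_profileWord hδ hp hP hK

/-- **Theorem 6.2**: the generating function for symmetric cylindric partitions
with profile `δ = (δ_1, …, δ_h)` is
`Σ_{ω ∈ SCP_δ} z^{|ω|}
  = ∏_{i<j, δ_i>δ_j} (1 - z^{2(j-i)})⁻¹ · Φ({z^{2i-1} : δ_i = -1})
      · ∏_{k≥1} Φ(z^{(2h+1)k}({z^{-2i+1} : δ_i = 1} + {z^{2i-1} : δ_i = -1}))/(1 - z^{(2h+1)k})`,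
the alphabet of the last `Φ` consisting of the monomials `z^{(2h+1)k - (2i-1)}`
for `δ_i = 1` and `z^{(2h+1)k + (2i-1)}` for `δ_i = -1`. -/
theorem gf_symmetric_cylindric_partitions_phi (h : ℕ) (hh : 1 ≤ h) (δ : ℕ → ℤ)
    (hδ : IsProfile h δ) :
    ∑' ω : {M : Fin (2 * h + 1) → Ptn // IsSCP h δ M}, z ^ scpSize h ω.1
    = (∏ q ∈ ((Finset.Icc 1 h) ×ˢ (Finset.Icc 1 h)).filter
          (fun q => q.1 < q.2 ∧ δ q.1 > δ q.2),
          (1 - z ^ (2 * (q.2 - q.1)))⁻¹) *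
        Phi (fun n => if n < h ∧ δ (n + 1) = -1 then z ^ (2 * (n + 1) - 1) else 0) *
        ∏' k : ℕ,
          Phi (fun n => if n < h then
              (if δ (n + 1) = 1 then z ^ ((2 * h + 1) * (k + 1) - (2 * (n + 1) - 1))
                else z ^ ((2 * h + 1) * (k + 1) + (2 * (n + 1) - 1)))
            else 0) *
            (1 - z ^ ((2 * h + 1) * (k + 1)))⁻¹ := by
  obtain ⟨p, hp, hP⟩ := exists_transfers_ups (2 * h + 1) (profileDir δ) (profileExp δ) h
    (fun j _ hj => by
      rw [profileDir, decide_eq_false_iff_not] at hj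
      rw [profileExp, if_neg hj]
      positivity)
    (fun j _ hj i hij => by
      rw [profileDir, decide_eq_false_iff_not] at hj
      rw [profileExp, profileExp, if_neg hj]
      split_ifs <;> omega) []
  rw [List.append_nil, List.append_nil] at hP
  rw [tsum_z_pow _ (admissible_scpSize h δ), weightGF_scpSize hδ, weightGF_profileWord hδ hp hP,
    prod_mul_Phi_eq hδ]
  congr 1
  refine tprod_congr fun k => ?_
  rw [Phi_eq_phiList hp, geomSeries_eq (a := (2 * h + 1) * (k + 1)) (by push_cast; rfl)]
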